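/- arXiv:2209.11177 — 2 statements merged into one kernel-verified Lean document; each statement's English description precedes it below -/
import Mathlib

section
/- Let Q be a homomorphism-closed query having a model with a tight edge, and let Θ be its critical weight. If I is a model of Q and e is a non-leaf edge of I whose weight is strictly less than Θ, then the dissociation of e in I is also a model of Q. -/
/- Formalization of instances over an arity-two relational signature,
homomorphisms, edges, dissociation, tightness, weights, etc. -/

namespace UR

attribute [local instance] Classical.propDecidable

/-- A fact `R(a,b)` over signature `σ` with constants from `C`. -/
structure Fact (σ C : Type) where
  rel : σ
  fst : C
  snd : C

variable {σ C : Type}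

/-- A fact uses a constant. -/
def Fact.uses (F : Fact σ C) (a : C) : Prop := F.fst = a ∨ F.snd = a

/-- An instance is a finite set of facts. -/
abbrev Instance (σ C : Type) := Finset (Fact σ C)

/-- Domain of an instance: constants occurring in its facts. -/
def dom (I : Instance σ C) : Set C := {a | ∃ F ∈ I, F.uses a}

/-- Applying a map of constants to a fact. -/
def mapFact (f : C → C) (F : Fact σ C) : Fact σ C := ⟨F.rel, f F.fst, f F.snd⟩

/-- `h` is a homomorphism from `I` to `I'`. -/
def IsHom (h : C → C) (I I' : Instance σ C) : Prop := ∀ F ∈ I, mapFact h F ∈ I'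

/-- A query is homomorphism-closed. -/
def HomClosed (Q : Instance σ C → Prop) : Prop :=
  ∀ (I I' : Instance σ C) (h : C → C), Q I → IsHom h I I' → Q I'

/-- Covering facts of the pair `(u,v)`: facts using both `u` and `v`. -/
noncomputable def covering (I : Instance σ C) (u v : C) : Instance σ C :=
  I.filter (fun F => F.uses u ∧ F.uses v)

/-- `(u,v)` is an edge of `I`. -/
def IsEdge (I : Instance σ C) (u v : C) : Prop := u ≠ v ∧ (covering I u v).Nonempty

/-- Left-incident facts of `(u,v)`: facts using `u` but not `v`.
(The right-incident facts of `(u,v)` are `leftIncident I v u`.) -/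
noncomputable def leftIncident (I : Instance σ C) (u v : C) : Instance σ C :=
  I.filter (fun F => F.uses u ∧ ¬ F.uses v)

/-- `(u,v)` is a non-leaf edge of `I`. -/
def IsNonLeafEdge (I : Instance σ C) (u v : C) : Prop :=
  IsEdge I u v ∧ (leftIncident I u v).Nonempty ∧ (leftIncident I v u).Nonempty

/-- The renaming sending `u` to `u'` and `v` to `v'`. -/
noncomputable def rename2 (u v u' v' : C) : C → C := fun a => if a = u then u' else if a = v then v' else a

/-- The renaming sending `a` to `b`. -/
noncomputable def rename1 (a b : C) : C → C := fun x => if x = a then b else x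

/-- Copying the edge `(u,v)` of `I` to the ordered pair `(u',v')`. -/
noncomputable def copyEdge (I : Instance σ C) (u v u' v' : C) : Instance σ C :=
  I ∪ (covering I u v).image (mapFact (rename2 u v u' v'))

/-- The dissociation of the non-leaf edge `(u,v)` in `I`, using fresh elements `u'` and `v'`:
copy `(u,v)` to `(u',v)` and to `(u,v')`, then remove the covering facts of `(u,v)`. -/
noncomputable def dissociation (I : Instance σ C) (u v u' v' : C) : Instance σ C :=
  (I ∪ (covering I u v).image (mapFact (rename2 u v u' v))
     ∪ (covering I u v).image (mapFact (rename2 u v u v'))) \ covering I u v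

/-- `(u,v)` is a tight edge of `I` for query `Q`: it is a non-leaf edge, `I` satisfies `Q`, and
the dissociation of `(u,v)` in `I` (with any choice of fresh elements) does not satisfy `Q`. -/
def IsTight (Q : Instance σ C → Prop) (I : Instance σ C) (u v : C) : Prop :=
  IsNonLeafEdge I u v ∧ Q I ∧
  ∀ u' v' : C, u' ∉ dom I → v' ∉ dom I → u' ≠ v' → ¬ Q (dissociation I u v u' v')

/-- The weight of an edge: number of covering facts. -/
noncomputable def weight (I : Instance σ C) (u v : C) : ℕ := (covering I u v).card

/-- `I` is a subinstance-minimal model of `Q`. -/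
def MinimalModel (Q : Instance σ C → Prop) (I : Instance σ C) : Prop :=
  Q I ∧ ∀ J : Instance σ C, J ⊂ I → ¬ Q J

/-- Two instances are isomorphic. -/
def IsIso (I J : Instance σ C) : Prop :=
  ∃ f : C → C, Function.Bijective f ∧ J = I.image (mapFact f)

/-- `Q` is unbounded: it has infinitely many subinstance-minimal models up to isomorphism,
i.e. no finite set of instances covers all its subinstance-minimal models up to isomorphism. -/
def Unbounded (Q : Instance σ C → Prop) : Prop :=
  ∀ S : Finset (Instance σ C), ∃ I, MinimalModel Q I ∧ ∀ J ∈ S, ¬ IsIso I J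

/-- The element `t` witnesses left garbage facts of the edge `(u,v)`: `(u,t)` is an edge whose
covering facts, renamed via `t ↦ v`, form a strict subset of the covering facts of `(u,v)`. -/
def HasLeftGarbage (I : Instance σ C) (u v t : C) : Prop :=
  t ≠ u ∧ t ≠ v ∧ IsEdge I u t ∧
    (covering I u t).image (mapFact (rename1 t v)) ⊂ covering I u v

/-- The element `w` witnesses right garbage facts of the edge `(u,v)`. -/
def HasRightGarbage (I : Instance σ C) (u v w : C) : Prop :=
  w ≠ u ∧ w ≠ v ∧ IsEdge I w v ∧
    (covering I w v).image (mapFact (rename1 w u)) ⊂ covering I u v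

/-- The edge `(u,v)` is clean: no left or right garbage facts. -/
def Clean (I : Instance σ C) (u v : C) : Prop :=
  (∀ t, ¬ HasLeftGarbage I u v t) ∧ (∀ w, ¬ HasRightGarbage I u v w)

/-- `F` is a left garbage fact of `(u,v)`. -/
def IsLeftGarbageFact (I : Instance σ C) (u v : C) (F : Fact σ C) : Prop :=
  ∃ t, HasLeftGarbage I u v t ∧ F ∈ covering I u t

/-- `F` is a right garbage fact of `(u,v)`. -/
def IsRightGarbageFact (I : Instance σ C) (u v : C) (F : Fact σ C) : Prop :=
  ∃ w, HasRightGarbage I u v w ∧ F ∈ covering I w v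

/-- `x` forms a triangle with the edge `(u,v)`. -/
def Triangle (I : Instance σ C) (u v x : C) : Prop := IsEdge I u x ∧ IsEdge I v x

/-- The edge `(u',v')` is a copy of the edge `(u,v)`: its covering facts are exactly the image
of the covering facts of `(u,v)` under the renaming `u ↦ u'`, `v ↦ v'`. -/
def IsCopy (I : Instance σ C) (u v u' v' : C) : Prop :=
  u' ≠ v' ∧ covering I u' v' = (covering I u v).image (mapFact (rename2 u v u' v'))

/-- `v'` is a left copy element of `(u,v)`. -/
def IsLeftCopyElem (I : Instance σ C) (u v v' : C) : Prop :=
  v' ≠ u ∧ v' ≠ v ∧ IsCopy I u v u v' ∧ ¬ Triangle I u v v'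

/-- `u'` is a right copy element of `(u,v)`. -/
def IsRightCopyElem (I : Instance σ C) (u v u' : C) : Prop :=
  u' ≠ u ∧ u' ≠ v ∧ IsCopy I u v u' v ∧ ¬ Triangle I u v u'

/-- `F` is a left copy fact of `(u,v)`. -/
def IsLeftCopyFact (I : Instance σ C) (u v : C) (F : Fact σ C) : Prop :=
  F ∈ leftIncident I u v ∧ ∃ v', IsLeftCopyElem I u v v' ∧ F.uses v'

/-- `F` is a right copy fact of `(u,v)`. -/
def IsRightCopyFact (I : Instance σ C) (u v : C) (F : Fact σ C) : Prop :=
  F ∈ leftIncident I v u ∧ ∃ u', IsRightCopyElem I u v u' ∧ F.uses u'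

/-- `F` is a left extra fact of `(u,v)`: a non-garbage left-incident fact which is unary on `u`,
or binary on `u` and an element `x` forming a triangle with `(u,v)` or such that the covering
facts of `(u,x)` are not isomorphic to those of `(u,v)`. -/
def IsLeftExtraFact (I : Instance σ C) (u v : C) (F : Fact σ C) : Prop :=
  F ∈ leftIncident I u v ∧ ¬ IsLeftGarbageFact I u v F ∧
    ((F.fst = u ∧ F.snd = u) ∨
      ∃ x, x ≠ u ∧ F.uses x ∧ (Triangle I u v x ∨ ¬ IsCopy I u v u x))

/-- `F` is a right extra fact of `(u,v)`. -/
def IsRightExtraFact (I : Instance σ C) (u v : C) (F : Fact σ C) : Prop :=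
  F ∈ leftIncident I v u ∧ ¬ IsRightGarbageFact I u v F ∧
    ((F.fst = v ∧ F.snd = v) ∨
      ∃ x, x ≠ v ∧ F.uses x ∧ (Triangle I u v x ∨ ¬ IsCopy I u v x v))

/-- The extra weight of `(u,v)`: number of extra facts. -/
noncomputable def extraWeight (I : Instance σ C) (u v : C) : ℕ :=
  (I.filter (fun F => IsLeftExtraFact I u v F ∨ IsRightExtraFact I u v F)).card

/-- The finite set of constants occurring in `I`. -/
noncomputable def constsOf (I : Instance σ C) : Finset C :=
  I.image Fact.fst ∪ I.image Fact.snd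

/-- The lexicographic weight of `(u,v)`: the pair (number of left copy elements,
number of right copy elements). -/
noncomputable def lexWeight (I : Instance σ C) (u v : C) : ℕ × ℕ :=
  (((constsOf I).filter (fun v' => IsLeftCopyElem I u v v')).card,
   ((constsOf I).filter (fun u' => IsRightCopyElem I u v u')).card)

/-- Lexicographic comparison of pairs of naturals. -/
def lexLt (p q : ℕ × ℕ) : Prop := p.1 < q.1 ∨ (p.1 = q.1 ∧ p.2 < q.2)

end UR

namespace UR

/-- let `Q` be a homomorphism-closed query having a model with a tight edge and
let `Θ` be its critical weight (the minimum weight of a tight edge across all models of `Q`).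
If `I` is a model of `Q` and `(u,v)` is a non-leaf edge of `I` of weight strictly less than `Θ`,
then the dissociation of `(u,v)` in `I` is also a model of `Q`. -/
theorem dissociation_model_of_weight_lt {σ C : Type} [Infinite C] (Q : Instance σ C → Prop)
    (hQ : HomClosed Q) (Θ : ℕ)
    (hΘ_ex : ∃ (I : Instance σ C) (u v : C), IsTight Q I u v ∧ weight I u v = Θ)
    (hΘ_min : ∀ (I : Instance σ C) (u v : C), IsTight Q I u v → Θ ≤ weight I u v)
    (I : Instance σ C) (u v : C) (hI : Q I) (hnl : IsNonLeafEdge I u v)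
    (hw : weight I u v < Θ)
    (u' v' : C) (hu' : u' ∉ dom I) (hv' : v' ∉ dom I) (huv : u' ≠ v') :
    Q (dissociation I u v u' v') := by
  classical
  by_contra hcon
  have hnt : ¬ IsTight Q I u v := fun ht => absurd (hΘ_min I u v ht) (by omega)
  obtain ⟨u1, v1, hu1, hv1, h11, hq⟩ : ∃ u1 v1 : C, u1 ∉ dom I ∧ v1 ∉ dom I ∧ u1 ≠ v1 ∧
      Q (dissociation I u v u1 v1) := by
    by_contra hno
    exact hnt ⟨hnl, hI, fun a b ha hb hab hQ' => hno ⟨a, b, ha, hb, hab, hQ'⟩⟩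
  apply hcon
  refine hQ _ _ (rename2 u1 v1 u' v') hq ?_
  obtain ⟨⟨hne, G0, hG0⟩, -, -⟩ := hnl
  have hG0' := (Finset.mem_filter.1 hG0)
  have hud : u ∈ dom I := ⟨G0, hG0'.1, hG0'.2.1⟩
  have hvd : v ∈ dom I := ⟨G0, hG0'.1, hG0'.2.2⟩
  have n1 : u ≠ u1 := fun h => hu1 (h ▸ hud)
  have n2 : u ≠ v1 := fun h => hv1 (h ▸ hud)
  have n3 : v ≠ u1 := fun h => hu1 (h ▸ hvd)
  have n4 : v ≠ v1 := fun h => hv1 (h ▸ hvd)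
  have n5 : u ≠ u' := fun h => hu' (h ▸ hud)
  have n6 : u ≠ v' := fun h => hv' (h ▸ hud)
  have n7 : v ≠ u' := fun h => hu' (h ▸ hvd)
  have n8 : v ≠ v' := fun h => hv' (h ▸ hvd)
  have key : ∀ G ∈ covering I u v, (G.fst = u ∧ G.snd = v) ∨ (G.fst = v ∧ G.snd = u) := by
    intro G hG
    have := (Finset.mem_filter.1 hG).2
    unfold Fact.uses at this
    grind
  intro F hF
  unfold dissociation at hF ⊢
  rw [Finset.mem_sdiff, Finset.mem_union, Finset.mem_union] at hF ⊢
  obtain ⟨(hF | hF) | hF, hnc⟩ := hF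
  · have a1 : ∀ x, F.uses x → x ≠ u1 ∧ x ≠ v1 := fun x hx =>
      ⟨fun h => hu1 ⟨F, hF, h ▸ hx⟩, fun h => hv1 ⟨F, hF, h ▸ hx⟩⟩
    have b1 := a1 F.fst (Or.inl rfl)
    have b2 := a1 F.snd (Or.inr rfl)
    have e : mapFact (rename2 u1 v1 u' v') F = F := by
      simp [mapFact, rename2, b1, b2]
    rw [e]
    exact ⟨Or.inl (Or.inl hF), hnc⟩
  · obtain ⟨G, hG, rfl⟩ := Finset.mem_image.1 hF
    have e : mapFact (rename2 u1 v1 u' v') (mapFact (rename2 u v u1 v) G)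
        = mapFact (rename2 u v u' v) G := by
      rcases key G hG with ⟨h1, h2⟩ | ⟨h1, h2⟩ <;>
        simp [mapFact, rename2, h1, h2, hne.symm, n3, n4]
    rw [e]
    refine ⟨Or.inl (Or.inr (Finset.mem_image_of_mem _ hG)), fun hc => ?_⟩
    have := key _ hc
    rcases key G hG with ⟨h1, h2⟩ | ⟨h1, h2⟩ <;>
      simp [mapFact, rename2, h1, h2, hne.symm, n5.symm, n7.symm] at this
  · obtain ⟨G, hG, rfl⟩ := Finset.mem_image.1 hF
    have e : mapFact (rename2 u1 v1 u' v') (mapFact (rename2 u v u v1) G)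
        = mapFact (rename2 u v u v') G := by
      rcases key G hG with ⟨h1, h2⟩ | ⟨h1, h2⟩ <;>
        simp [mapFact, rename2, h1, h2, hne.symm, n1, n2, h11.symm]
    rw [e]
    refine ⟨Or.inr (Finset.mem_image_of_mem _ hG), fun hc => ?_⟩
    have := key _ hc
    rcases key G hG with ⟨h1, h2⟩ | ⟨h1, h2⟩ <;>
      simp [mapFact, rename2, h1, h2, hne.symm, n6.symm, n8.symm, hne] at this

end UR
end

section
/- If a homomorphism-closed query Q has a model with a tight edge, then Q has a model I with a tight edge e that is clean and has weight equal to the critical weight Θ of Q. -/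
/- Formalization of instances over an arity-two relational signature,
homomorphisms, edges, dissociation, tightness, weights, etc. -/

namespace UR

attribute [local instance] Classical.propDecidable

variable {σ C : Type}

end UR

namespace UR

attribute [local instance] Classical.propDecidable

theorem mem_cov {σ C : Type} {I : Instance σ C} {u v : C} (huv : u ≠ v) (r : σ) (x y : C) :
    (⟨r, x, y⟩ : Fact σ C) ∈ covering I u v ↔
      (⟨r, x, y⟩ : Fact σ C) ∈ I ∧ ((x = u ∧ y = v) ∨ (x = v ∧ y = u)) := by
  simp only [covering, Finset.mem_filter, Fact.uses]
  grind

theorem mem_left {σ C : Type} {I : Instance σ C} {u v : C} (r : σ) (x y : C) :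
    (⟨r, x, y⟩ : Fact σ C) ∈ leftIncident I u v ↔
      (⟨r, x, y⟩ : Fact σ C) ∈ I ∧ (x = u ∨ y = u) ∧ x ≠ v ∧ y ≠ v := by
  simp only [leftIncident, Finset.mem_filter, Fact.uses]
  grind

theorem mem_img {σ C : Type} {I : Instance σ C} (f : C → C) (r : σ) (x y : C) :
    (⟨r, x, y⟩ : Fact σ C) ∈ I.image (mapFact f) ↔
      ∃ p q, (⟨r, p, q⟩ : Fact σ C) ∈ I ∧ f p = x ∧ f q = y := by
  simp only [Finset.mem_image, mapFact]
  constructor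
  · rintro ⟨⟨r', p, q⟩, h, h2⟩
    simp only [Fact.mk.injEq] at h2
    obtain ⟨rfl, h3, h4⟩ := h2
    exact ⟨p, q, h, h3, h4⟩
  · rintro ⟨p, q, h, h3, h4⟩
    exact ⟨_, h, by simp [h3, h4]⟩

theorem mem_diss {σ C : Type} {I : Instance σ C} {u v a b : C} (huv : u ≠ v) (r : σ) (x y : C) :
    (⟨r, x, y⟩ : Fact σ C) ∈ dissociation I u v a b ↔
      ((⟨r, x, y⟩ : Fact σ C) ∈ I ∨
        ((⟨r, u, v⟩ : Fact σ C) ∈ I ∧ ((x = a ∧ y = v) ∨ (x = u ∧ y = b))) ∨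
        ((⟨r, v, u⟩ : Fact σ C) ∈ I ∧ ((x = v ∧ y = a) ∨ (x = b ∧ y = u)))) ∧
      ¬ ((⟨r, x, y⟩ : Fact σ C) ∈ I ∧ ((x = u ∧ y = v) ∨ (x = v ∧ y = u))) := by
  simp only [dissociation, Finset.mem_sdiff, Finset.mem_union, mem_img, mem_cov huv, rename2]
  refine and_congr_left' ?_
  constructor
  · grind
  · rintro (h | ⟨h, h' | h'⟩ | ⟨h, h' | h'⟩)
    · exact Or.inl (Or.inl h)
    · exact Or.inl (Or.inr ⟨u, v, by grind⟩)
    · exact Or.inr ⟨u, v, by grind⟩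
    · exact Or.inl (Or.inr ⟨v, u, by grind⟩)
    · exact Or.inr ⟨v, u, by grind⟩

theorem cov_comm {σ C : Type} (I : Instance σ C) (u v : C) : covering I u v = covering I v u := by
  unfold covering
  congr 1
  ext F
  exact and_comm

theorem diss_comm {σ C : Type} {I : Instance σ C} {u v a b : C} (huv : u ≠ v) :
    dissociation I u v a b = dissociation I v u b a := by
  ext ⟨r, x, y⟩
  rw [mem_diss huv, mem_diss huv.symm]
  grind

theorem tight_comm {σ C : Type} {Q : Instance σ C → Prop} {I : Instance σ C} {u v : C}
    (h : IsTight Q I u v) : IsTight Q I v u := by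
  obtain ⟨⟨⟨h1, h2⟩, h3, h4⟩, h5, h6⟩ := h
  refine ⟨⟨⟨h1.symm, cov_comm I u v ▸ h2⟩, h4, h3⟩, h5, ?_⟩
  intro a b ha hb hab
  rw [← diss_comm h1]
  exact h6 b a hb ha hab.symm

theorem garbage_comm {σ C : Type} {I : Instance σ C} {u v w : C}
    (h : HasRightGarbage I u v w) : HasLeftGarbage I v u w := by
  obtain ⟨h1, h2, ⟨h3, h4⟩, h5⟩ := h
  refine ⟨h2, h1, ⟨h3.symm, cov_comm I w v ▸ h4⟩, ?_⟩
  rw [cov_comm I v w, cov_comm I v u]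
  exact h5

theorem mem_dom {σ C : Type} {I : Instance σ C} {r : σ} {x y : C}
    (h : (⟨r, x, y⟩ : Fact σ C) ∈ I) : x ∈ dom I ∧ y ∈ dom I :=
  ⟨⟨_, h, Or.inl rfl⟩, ⟨_, h, Or.inr rfl⟩⟩

theorem dom_finite {σ C : Type} (I : Instance σ C) : (dom I).Finite := by
  refine (constsOf I).finite_toSet.subset ?_
  rintro a ⟨F, hF, h | h⟩
  · simp only [constsOf, Finset.coe_union, Finset.coe_image]
    exact Or.inl ⟨F, hF, h⟩
  · simp only [constsOf, Finset.coe_union, Finset.coe_image]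
    exact Or.inr ⟨F, hF, h⟩

theorem fresh2 {σ C : Type} [Infinite C] (I : Instance σ C) :
    ∃ a b : C, a ∉ dom I ∧ b ∉ dom I ∧ a ≠ b := by
  obtain ⟨a, ha⟩ := (dom_finite I).exists_notMem
  obtain ⟨b, hb⟩ := ((dom_finite I).insert a).exists_notMem
  exact ⟨a, b, ha, fun h => hb (Or.inr h), fun h => hb (Or.inl h.symm)⟩

/-- the cleaned instance -/
noncomputable def cleaned {σ C : Type} (I : Instance σ C) (u t u' : C) : Instance σ C :=
  (I \ covering I u t) ∪ (covering I u t).image (mapFact (rename1 u u'))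

theorem mem_cleaned {σ C : Type} {I : Instance σ C} {u t u' : C} (hut : u ≠ t)
    (r : σ) (x y : C) :
    (⟨r, x, y⟩ : Fact σ C) ∈ cleaned I u t u' ↔
      ((⟨r, x, y⟩ : Fact σ C) ∈ I ∧ ¬ ((x = u ∧ y = t) ∨ (x = t ∧ y = u))) ∨
      ((⟨r, u, t⟩ : Fact σ C) ∈ I ∧ x = u' ∧ y = t) ∨
      ((⟨r, t, u⟩ : Fact σ C) ∈ I ∧ x = t ∧ y = u') := by
  simp only [cleaned, Finset.mem_sdiff, Finset.mem_union, mem_img, mem_cov hut, rename1]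
  constructor
  · grind
  · rintro (h | h | h)
    · exact Or.inl (by grind)
    · exact Or.inr ⟨u, t, by grind⟩
    · exact Or.inr ⟨t, u, by grind⟩

theorem step {σ C : Type} [Infinite C] (Q : Instance σ C → Prop)
    (hQ : HomClosed Q) (Θ : ℕ)
    (hmin : ∀ (I : Instance σ C) (u v : C), IsTight Q I u v → Θ ≤ weight I u v)
    (I : Instance σ C) (u v t : C) (hT : IsTight Q I u v) (hw : weight I u v = Θ)
    (hg : HasLeftGarbage I u v t) :
    ∃ J, IsTight Q J u v ∧ weight J u v = Θ ∧
      (leftIncident J u v).card + (leftIncident J v u).card <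
      (leftIncident I u v).card + (leftIncident I v u).card := by
  obtain ⟨⟨⟨huv, hcov⟩, hl, hr⟩, hQI, hnd⟩ := hT
  obtain ⟨htu, htv, ⟨hut, hcovt⟩, hsub⟩ := hg
  obtain ⟨u', w', hu', hw', huw'⟩ := fresh2 I
  -- membership form of the garbage inclusion
  have g1 : ∀ r, (⟨r, u, t⟩ : Fact σ C) ∈ I → (⟨r, u, v⟩ : Fact σ C) ∈ I := by
    intro r h
    have := hsub.1 ((mem_img _ r u v).2 ⟨u, t, (mem_cov hut _ _ _).2 ⟨h, by simp⟩, by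
      simp [rename1, hut], by simp [rename1]⟩)
    exact ((mem_cov huv _ _ _).1 this).1
  have g2 : ∀ r, (⟨r, t, u⟩ : Fact σ C) ∈ I → (⟨r, v, u⟩ : Fact σ C) ∈ I := by
    intro r h
    have := hsub.1 ((mem_img _ r v u).2 ⟨t, u, (mem_cov hut _ _ _).2 ⟨h, by simp⟩, by
      simp [rename1], by simp [rename1, hut]⟩)
    exact ((mem_cov huv _ _ _).1 this).1
  have hwt : weight I u t < Θ := by
    rw [← hw]
    have h1 := Finset.card_lt_card hsub
    rw [Finset.card_image_of_injOn] at h1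
    · exact h1
    · rintro ⟨r, x, y⟩ h ⟨r', x', y'⟩ h' he
      have h := (mem_cov hut _ _ _).1 (Finset.mem_coe.1 h)
      have h' := (mem_cov hut _ _ _).1 (Finset.mem_coe.1 h')
      simp only [mapFact, rename1, Fact.mk.injEq] at he ⊢
      grind
  have hF : ∃ r x y, (⟨r, x, y⟩ : Fact σ C) ∈ I ∧ ((x = u ∧ y = v) ∨ (x = v ∧ y = u)) := by
    obtain ⟨⟨r, x, y⟩, h⟩ := hcov
    exact ⟨r, x, y, (mem_cov huv _ _ _).1 h⟩
  have hG : ∃ r x y, (⟨r, x, y⟩ : Fact σ C) ∈ I ∧ ((x = u ∧ y = t) ∨ (x = t ∧ y = u)) := by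
    obtain ⟨⟨r, x, y⟩, h⟩ := hcovt
    exact ⟨r, x, y, (mem_cov hut _ _ _).1 h⟩
  have hud : u ∈ dom I ∧ v ∈ dom I := by
    obtain ⟨r, x, y, h, h'⟩ := hF
    have := mem_dom h
    grind
  have htd : t ∈ dom I := by
    obtain ⟨r, x, y, h, h'⟩ := hG
    have := mem_dom h
    grind
  have hu'u : u' ≠ u := fun h => hu' (h ▸ hud.1)
  have hu'v : u' ≠ v := fun h => hu' (h ▸ hud.2)
  have hu't : u' ≠ t := fun h => hu' (h ▸ htd)
  set J := cleaned I u t u' with hJ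
  have memJ := fun r x y => mem_cleaned (I := I) (u' := u') hut r x y
  rw [← hJ] at memJ
  have hQJ : Q J := by
    by_cases hnl : IsNonLeafEdge I u t
    · have : ¬ IsTight Q I u t := fun h => absurd (hmin _ _ _ h) (by omega)
      simp only [IsTight, not_and, not_forall, not_not] at this
      obtain ⟨a, b, ha, hb, hab, hq⟩ := this hnl hQI
      refine hQ _ _ (fun x => if x = a then u' else if x = b then v else x) hq ?_
      rintro ⟨r, x, y⟩ h
      have hau : a ≠ u := fun h => ha (h ▸ hud.1)
      have hat : a ≠ t := fun h => ha (h ▸ htd)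
      have hbu : b ≠ u := fun h => hb (h ▸ hud.1)
      have hbt : b ≠ t := fun h => hb (h ▸ htd)
      obtain ⟨h1 | ⟨h1, ⟨rfl, rfl⟩ | ⟨rfl, rfl⟩⟩ | ⟨h1, ⟨rfl, rfl⟩ | ⟨rfl, rfl⟩⟩, h2⟩ :=
        (mem_diss hut _ _ _).1 h
      · have := mem_dom h1
        have e1 : x ≠ a := fun h => ha (h ▸ this.1)
        have e2 : x ≠ b := fun h => hb (h ▸ this.1)
        have e3 : y ≠ a := fun h => ha (h ▸ this.2)
        have e4 : y ≠ b := fun h => hb (h ▸ this.2)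
        simp only [mapFact, e1, e2, e3, e4, if_false, memJ]
        exact Or.inl ⟨h1, fun h => h2 ⟨h1, h⟩⟩
      · simp only [mapFact, memJ]
        grind
      · have := g1 r h1
        simp only [mapFact, memJ]
        grind
      · simp only [mapFact, memJ]
        grind
      · have := g2 r h1
        simp only [mapFact, memJ]
        grind
    · have hleaf : ∀ r x y, (⟨r, x, y⟩ : Fact σ C) ∈ I → (x = t ∨ y = t) → (x = u ∨ y = u) := by
        intro r x y h h1
        by_contra h2
        apply hnl
        refine ⟨⟨hut, hcovt⟩, ?_, ⟨⟨r, x, y⟩, (mem_left _ _ _).2 (by grind)⟩⟩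
        obtain ⟨r, x, y, h, h'⟩ := hF
        exact ⟨⟨r, x, y⟩, (mem_left _ _ _).2 (by grind)⟩
      refine hQ _ _ (rename1 t v) hQI ?_
      rintro ⟨r, x, y⟩ h
      have h1 := hleaf r x y h
      simp only [mapFact, rename1, memJ]
      have h2 := g1 r
      have h3 := g2 r
      grind
  have hcJ : covering J u v = covering I u v := by
    ext ⟨r, x, y⟩
    rw [mem_cov huv, mem_cov huv, memJ]
    grind
  have hrJ : leftIncident I v u ⊆ leftIncident J v u := by
    rintro ⟨r, x, y⟩ h
    rw [mem_left] at h ⊢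
    rw [memJ]
    grind
  have hrJ' : leftIncident J v u ⊆ leftIncident I v u := by
    rintro ⟨r, x, y⟩ h
    rw [mem_left] at h ⊢
    rw [memJ] at h
    grind
  have hlJ : leftIncident J u v ⊂ leftIncident I u v := by
    refine (Finset.ssubset_iff_of_subset ?_).2 ?_
    · rintro ⟨r, x, y⟩ h
      rw [mem_left] at h ⊢
      rw [memJ] at h
      grind
    · obtain ⟨r, x, y, h, h'⟩ := hG
      refine ⟨⟨r, x, y⟩, (mem_left _ _ _).2 (by grind), fun h2 => ?_⟩
      rw [mem_left, memJ] at h2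
      grind
  have hJuv : ∀ r x y, ((x = u ∧ y = v) ∨ (x = v ∧ y = u)) →
      ((⟨r, x, y⟩ : Fact σ C) ∈ J ↔ (⟨r, x, y⟩ : Fact σ C) ∈ I) := by
    intro r x y h
    rw [memJ]
    grind
  have hJdom : u ∈ dom J ∧ v ∈ dom J := by
    obtain ⟨r, x, y, h, h'⟩ := hF
    have := mem_dom ((hJuv r x y h').2 h)
    grind
  have hJdom' : u' ∈ dom J := by
    obtain ⟨r, x, y, h, ⟨rfl, rfl⟩ | ⟨rfl, rfl⟩⟩ := hG
    · exact (mem_dom ((memJ r u' y).2 (by grind))).1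
    · exact (mem_dom ((memJ r x u').2 (by grind))).2
  have hndJ : ∀ a b : C, a ∉ dom J → b ∉ dom J → a ≠ b → ¬ Q (dissociation J u v a b) := by
    intro a b ha hb hab hq
    obtain ⟨a', b', ha', hb', hab'⟩ := fresh2 I
    refine hnd a' b' ha' hb' hab' (hQ _ _
      (fun x => if x = a then a' else if x = b then b' else if x = u' then u else x) hq ?_)
    have hau : a ≠ u := fun h => ha (h ▸ hJdom.1)
    have hav : a ≠ v := fun h => ha (h ▸ hJdom.2)
    have hbu : b ≠ u := fun h => hb (h ▸ hJdom.1)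
    have hbv : b ≠ v := fun h => hb (h ▸ hJdom.2)
    have hau' : a ≠ u' := fun h => ha (h ▸ hJdom')
    have hbu' : b ≠ u' := fun h => hb (h ▸ hJdom')
    have ha'u : a' ≠ u := fun h => ha' (h ▸ hud.1)
    have ha'v : a' ≠ v := fun h => ha' (h ▸ hud.2)
    have hb'u : b' ≠ u := fun h => hb' (h ▸ hud.1)
    have hb'v : b' ≠ v := fun h => hb' (h ▸ hud.2)
    rintro ⟨r, x, y⟩ h
    obtain ⟨h1 | ⟨h1, ⟨rfl, rfl⟩ | ⟨rfl, rfl⟩⟩ | ⟨h1, ⟨rfl, rfl⟩ | ⟨rfl, rfl⟩⟩, h2⟩ :=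
      (mem_diss huv _ _ _).1 h
    · have := mem_dom h1
      have e1 : x ≠ a := fun h => ha (h ▸ this.1)
      have e2 : x ≠ b := fun h => hb (h ▸ this.1)
      have e3 : y ≠ a := fun h => ha (h ▸ this.2)
      have e4 : y ≠ b := fun h => hb (h ▸ this.2)
      have h3 : ¬ ((x = u ∧ y = v) ∨ (x = v ∧ y = u)) := fun h => h2 ⟨h1, h⟩
      simp only [mapFact, e1, e2, e3, e4, if_false, mem_diss huv]
      rcases (memJ _ _ _).1 h1 with ⟨h4, h5⟩ | ⟨h4, rfl, rfl⟩ | ⟨h4, rfl, rfl⟩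
      · have := mem_dom h4
        have e5 : x ≠ u' := fun h => hu' (h ▸ this.1)
        have e6 : y ≠ u' := fun h => hu' (h ▸ this.2)
        simp only [e5, e6, if_false]
        exact ⟨Or.inl h4, fun h => h3 h.2⟩
      · grind
      · grind
    all_goals
      have h3 := (hJuv r _ _ (by simp)).1 h1
      simp only [mapFact, mem_diss huv]
      grind
  refine ⟨J, ⟨⟨⟨huv, hcJ ▸ hcov⟩, ?_, hr.mono hrJ⟩, hQJ, hndJ⟩, ?_, ?_⟩
  · by_contra hne
    rw [Finset.not_nonempty_iff_eq_empty] at hne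
    have hno : ∀ r x y, (⟨r, x, y⟩ : Fact σ C) ∈ J → (x = u ∨ y = u) → (x = v ∨ y = v) := by
      intro r x y h h1
      by_contra h2
      have : (⟨r, x, y⟩ : Fact σ C) ∈ leftIncident J u v := (mem_left _ _ _).2 (by grind)
      rw [hne] at this
      simp at this
    obtain ⟨a, b, ha, hb, hab⟩ := fresh2 J
    refine hndJ a b ha hb hab (hQ _ _ (rename1 u a) hQJ ?_)
    have hau : a ≠ u := fun h => ha (h ▸ hJdom.1)
    rintro ⟨r, x, y⟩ h
    have h1 := hno r x y h
    simp only [mapFact, rename1, mem_diss huv]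
    by_cases hx : x = u <;> by_cases hy : y = u <;> grind
  · unfold weight at hw ⊢
    rw [hcJ, hw]
  · have h1 := Finset.card_lt_card hlJ
    have h2 := Finset.card_le_card hrJ'
    omega

/-- if a homomorphism-closed query `Q` has a model with a tight edge, then `Q` has
a model `I` with a tight edge `(u,v)` that is clean and has weight equal to the critical
weight `Θ` of `Q`. -/
theorem exists_clean_tight_edge {σ C : Type} [Infinite C] (Q : Instance σ C → Prop)
    (hQ : HomClosed Q) (Θ : ℕ)
    (hΘ_ex : ∃ (I : Instance σ C) (u v : C), IsTight Q I u v ∧ weight I u v = Θ)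
    (hΘ_min : ∀ (I : Instance σ C) (u v : C), IsTight Q I u v → Θ ≤ weight I u v) :
    ∃ (I : Instance σ C) (u v : C),
      Q I ∧ IsTight Q I u v ∧ Clean I u v ∧ weight I u v = Θ := by
  have key : ∀ n : ℕ, ∀ (I : Instance σ C) (u v : C), IsTight Q I u v → weight I u v = Θ →
      (leftIncident I u v).card + (leftIncident I v u).card = n →
      ∃ (I : Instance σ C) (u v : C),
        Q I ∧ IsTight Q I u v ∧ Clean I u v ∧ weight I u v = Θ := by
    intro n
    induction n using Nat.strong_induction_on with
    | _ n ih =>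
      intro I u v hT hw hn
      by_cases hl : ∃ t, HasLeftGarbage I u v t
      · obtain ⟨t, ht⟩ := hl
        obtain ⟨J, h1, h2, h3⟩ := step Q hQ Θ hΘ_min I u v t hT hw ht
        exact ih _ (hn ▸ h3) J u v h1 h2 rfl
      by_cases hr : ∃ t, HasRightGarbage I u v t
      · obtain ⟨t, ht⟩ := hr
        have hw' : weight I v u = Θ := by
          unfold weight at hw ⊢
          rw [cov_comm, hw]
        obtain ⟨J, h1, h2, h3⟩ := step Q hQ Θ hΘ_min I v u t (tight_comm hT) hw' (garbage_comm ht)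
        exact ih _ (by omega) J v u h1 h2 rfl
      · exact ⟨I, u, v, hT.2.1, hT, ⟨not_exists.1 hl, not_exists.1 hr⟩, hw⟩
  obtain ⟨I, u, v, hT, hw⟩ := hΘ_ex
  exact key _ I u v hT hw rfl

end UR
end
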